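/- arXiv:2208.13209 — 2 statements merged into one kernel-verified Lean document; each statement's English description precedes it below -/
import Mathlib

section
/- Let (M,d) be a connected compact metric space and f : M → M a continuous uniformly expanding map, i.e. there exist σ > 1 and δ > 0 such that for every x ∈ M the image f(B(x,δ)) of the open ball B(x,δ) contains a neighbourhood of the closure of the ball B(f(x),δ), and d(f(a),f(b)) ≥ σ·d(a,b) for all a,b ∈ B(x,δ). Then f is topologically exact: for every nonempty open set V ⊆ M there exists k ∈ ℕ with f^k(V) = M. -/
open Metric Set Filter Topology

/-- `f` is topologically exact: every nonempty open set has an iterate whose image is all of `M`. -/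
def TopologicallyExact {M : Type*} [TopologicalSpace M] (f : M → M) : Prop :=
  ∀ V : Set M, IsOpen V → V.Nonempty → ∃ k : ℕ, f^[k] '' V = Set.univ

/-- Every point `x` of the fibre of `f^[n]` over `a` has a companion in the fibre over `b` at
distance at most `C / σ ^ n`, uniformly in `n`. -/
def FibresWithin {M : Type*} [MetricSpace M] (f : M → M) (σ C : ℝ) (a b : M) : Prop :=
  ∀ (n : ℕ) (x : M), f^[n] x = a → ∃ p, f^[n] p = b ∧ σ ^ n * dist x p ≤ C

lemma FibresWithin.mono {M : Type*} [MetricSpace M] {f : M → M} {σ C D : ℝ} {a b : M}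
    (h : FibresWithin f σ C a b) (hCD : C ≤ D) : FibresWithin f σ D a b := by
  intro n x hx
  obtain ⟨p, hp, hxp⟩ := h n x hx
  exact ⟨p, hp, hxp.trans hCD⟩

lemma FibresWithin.trans {M : Type*} [MetricSpace M] {f : M → M} {σ C D : ℝ} {a b c : M}
    (hσ : 0 ≤ σ) (hab : FibresWithin f σ C a b) (hbc : FibresWithin f σ D b c) :
    FibresWithin f σ (C + D) a c := by
  intro n x hx
  obtain ⟨p, hp, hxp⟩ := hab n x hx
  obtain ⟨q, hq, hpq⟩ := hbc n p hp
  refine ⟨q, hq, ?_⟩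
  calc σ ^ n * dist x q ≤ σ ^ n * (dist x p + dist p q) := by
        gcongr
        exact dist_triangle x p q
    _ = σ ^ n * dist x p + σ ^ n * dist p q := mul_add _ _ _
    _ ≤ C + D := add_le_add hxp hpq

/-- Contracting inverse branches: points closer than `δ` to `f^[n] x` lift to points near `x`. -/
lemma exists_iterate_eq_of_dist_lt {M : Type*} [MetricSpace M] {f : M → M} {σ δ : ℝ}
    (hσ : 1 < σ) (hδ : 0 < δ)
    (hcover : ∀ x : M, ball (f x) δ ⊆ f '' ball x δ)
    (hexp : ∀ x : M, ∀ p ∈ ball x δ, ∀ q ∈ ball x δ, σ * dist p q ≤ dist (f p) (f q))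
    (n : ℕ) (x y : M) (hy : dist (f^[n] x) y < δ) :
    ∃ p, f^[n] p = y ∧ σ ^ n * dist x p ≤ dist (f^[n] x) y := by
  induction n generalizing y with
  | zero => exact ⟨y, rfl, by simp⟩
  | succ n ih =>
    rw [Function.iterate_succ_apply'] at hy ⊢
    obtain ⟨z, hz, rfl⟩ := hcover (f^[n] x) (mem_ball'.2 hy)
    obtain ⟨p, rfl, hp⟩ := ih z (mem_ball'.1 hz)
    refine ⟨p, Function.iterate_succ_apply' f n p, ?_⟩
    calc σ ^ (n + 1) * dist x p = σ * (σ ^ n * dist x p) := by ring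
      _ ≤ σ * dist (f^[n] x) (f^[n] p) := by gcongr
      _ ≤ _ := hexp _ _ (mem_ball_self hδ) _ hz

/-- If nearby points have uniformly close fibres, then so do all pairs of points of a connected
compact space, with a common constant. -/
lemma exists_forall_fibresWithin {M : Type*} [MetricSpace M] [CompactSpace M]
    [PreconnectedSpace M] {f : M → M} {σ δ : ℝ} (hσ : 0 ≤ σ) (hδ : 0 < δ)
    (hnear : ∀ a b : M, dist a b < δ → FibresWithin f σ δ a b) :
    ∃ C, ∀ a b : M, FibresWithin f σ C a b := by
  have hpair : ∀ a b : M, ∃ C, FibresWithin f σ C a b := by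
    intro a b
    refine PreconnectedSpace.induction₂' (fun a b => ∃ C, FibresWithin f σ C a b) ?_ ?_ a b
    · intro x
      filter_upwards [ball_mem_nhds x hδ] with y hy
      exact ⟨⟨δ, hnear x y (mem_ball'.1 hy)⟩, ⟨δ, hnear y x (mem_ball.1 hy)⟩⟩
    · exact ⟨fun _ _ _ ⟨C, hC⟩ ⟨D, hD⟩ => ⟨C + D, hC.trans hσ hD⟩⟩
  have huniform : ∃ C, ∀ z ∈ (univ : Set (M × M)), FibresWithin f σ C z.1 z.2 := by
    refine isCompact_univ.induction_on
      (p := fun s : Set (M × M) => ∃ C, ∀ z ∈ s, FibresWithin f σ C z.1 z.2)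
      ⟨0, by simp⟩ (fun s t hst ⟨C, hC⟩ => ⟨C, fun z hz => hC z (hst hz)⟩) ?_ ?_
    · rintro s t ⟨C, hC⟩ ⟨D, hD⟩
      exact ⟨max C D, fun z hz => hz.elim (fun h => (hC z h).mono (le_max_left C D))
        fun h => (hD z h).mono (le_max_right C D)⟩
    · rintro ⟨a, b⟩ -
      obtain ⟨C, hC⟩ := hpair a b
      refine ⟨ball a δ ×ˢ ball b δ, mem_nhdsWithin_of_mem_nhds
        (prod_mem_nhds (ball_mem_nhds a hδ) (ball_mem_nhds b hδ)), δ + C + δ, ?_⟩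
      rintro ⟨a', b'⟩ ⟨ha, hb⟩
      exact ((hnear a' a (mem_ball.1 ha)).trans hσ hC).trans hσ (hnear b b' (mem_ball'.1 hb))
  obtain ⟨C, hC⟩ := huniform
  exact ⟨C, fun a b => hC (a, b) (mem_univ _)⟩

/-- A continuous uniformly expanding map on a connected compact metric space is topologically
exact: here `f` is uniformly expanding with constants `σ > 1, δ > 0`, i.e. for every `x` the image
`f(B(x,δ))` contains a neighbourhood of the closure of `B(f(x),δ)`, and
`d(f(a),f(b)) ≥ σ·d(a,b)` on each ball `B(x,δ)`. -/
theorem uniformly_expanding_topologically_exact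
    {M : Type*} [MetricSpace M] [CompactSpace M] [ConnectedSpace M]
    (f : M → M) (hf : Continuous f)
    (σ δ : ℝ) (hσ : 1 < σ) (hδ : 0 < δ)
    (hcover : ∀ x : M, f '' Metric.ball x δ ∈ 𝓝ˢ (closure (Metric.ball (f x) δ)))
    (hexp : ∀ x : M, ∀ p ∈ Metric.ball x δ, ∀ q ∈ Metric.ball x δ,
      σ * dist p q ≤ dist (f p) (f q)) :
    TopologicallyExact f := by
  have hσ0 : 0 < σ := zero_lt_one.trans hσ
  have hball : ∀ x : M, ball (f x) δ ⊆ f '' ball x δ := fun x =>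
    subset_closure.trans (subset_of_mem_nhdsSet (hcover x))
  have hnear : ∀ a b : M, dist a b < δ → FibresWithin f σ δ a b := by
    rintro _ b hab n x rfl
    obtain ⟨p, hp, hxp⟩ := exists_iterate_eq_of_dist_lt hσ hδ hball hexp n x b hab
    exact ⟨p, hp, hxp.trans hab.le⟩
  obtain ⟨C, hC⟩ := exists_forall_fibresWithin hσ0.le hδ hnear
  rintro V hV ⟨x, hx⟩
  obtain ⟨ε, hε, hεV⟩ := Metric.isOpen_iff.1 hV x hx
  obtain ⟨n, hn⟩ := pow_unbounded_of_one_lt (C / ε) hσ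
  refine ⟨n, eq_univ_of_forall fun b => ?_⟩
  obtain ⟨p, hp, hxp⟩ := hC (f^[n] x) b n x rfl
  refine ⟨p, hεV (mem_ball'.2 ?_), hp⟩
  exact lt_of_mul_lt_mul_left (hxp.trans_lt ((div_lt_iff₀ hε).1 hn)) (pow_pos hσ0 n).le
end

section
/- Let T : 𝕋 → 𝕋 be a C¹ expanding map of the circle 𝕋 = ℝ/ℤ, i.e. T is continuously differentiable with |T'(x)| > 1 for all x ∈ 𝕋. Let 0 < β ≤ 1 and let f : 𝕋 → ℝ be a β-Hölder continuous function such that ∫ f dμ ≥ 0 for every T-invariant Borel probability measure μ. Then there exists a β-Hölder function φ : 𝕋 → ℝ such that f(x) ≥ φ(x) − φ(T(x)) for every x ∈ 𝕋. -/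
open MeasureTheory Metric Set Filter Topology

namespace CircleExpanding

lemma expands_and_surjective_of_le_deriv {g : ℝ → ℝ} (hg : Differentiable ℝ g) {c : ℝ}
    (hc : 0 < c) (hd : ∀ x, c ≤ deriv g x) :
    (∀ a b, c * |a - b| ≤ |g a - g b|) ∧ Function.Surjective g := by
  have key : ∀ a b, a ≤ b → c * (b - a) ≤ g b - g a := fun a b hab =>
    mul_sub_le_image_sub_of_le_deriv hg hd hab
  refine ⟨fun a b => ?_, hg.continuous.surjective ?_ ?_⟩
  · rcases le_total a b with h | h
    · rw [abs_sub_comm a b, abs_sub_comm (g a), abs_of_nonneg (sub_nonneg.2 h)]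
      exact (key a b h).trans (le_abs_self _)
    · rw [abs_of_nonneg (sub_nonneg.2 h)]
      exact (key b a h).trans (le_abs_self _)
  · refine tendsto_atTop_mono' atTop (f₁ := fun x => g 0 + c * x) ?_
      (tendsto_atTop_add_const_left _ _ (tendsto_id.const_mul_atTop hc))
    filter_upwards [eventually_ge_atTop 0] with x hx
    linarith [key 0 x hx]
  · refine tendsto_atBot_mono' atBot (f₁ := fun x => g 0 + c * x) ?_
      (tendsto_atBot_add_const_left _ _ (tendsto_id.const_mul_atBot hc))
    filter_upwards [eventually_le_atBot 0] with x hx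
    linarith [key x 0 hx]

/-- A continuous integer-valued function on the line is constant. -/
lemma eq_of_continuous_of_int_valued {h : ℝ → ℝ} (hc : Continuous h)
    (hi : ∀ x, ∃ m : ℤ, h x = m) (a b : ℝ) : h a = h b := by
  wlog hab : h a ≤ h b generalizing a b
  · exact (this b a (le_of_not_ge hab)).symm
  by_contra hne
  obtain ⟨m, hm⟩ := hi a
  obtain ⟨k, hk⟩ := hi b
  have hmk : m < k := by
    have := lt_of_le_of_ne hab hne
    rw [hm, hk] at this
    exact_mod_cast this
  have hmk' : (m : ℝ) + 1 ≤ k := by exact_mod_cast hmk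
  obtain ⟨x, hx⟩ := mem_range_of_exists_le_of_exists_ge hc (c := (m : ℝ) + 1 / 2)
    ⟨a, by rw [hm]; linarith⟩ ⟨b, by rw [hk]; linarith⟩
  obtain ⟨j, hj⟩ := hi x
  rw [hj] at hx
  have h1 : (m : ℝ) < j := by linarith
  have h2 : (j : ℝ) < m + 1 := by linarith
  norm_cast at h1 h2
  omega

lemma periodic_deriv_of_lift {T : UnitAddCircle → UnitAddCircle} {F : ℝ → ℝ}
    (hF : Continuous F) (hTF : ∀ x : ℝ, T (x : UnitAddCircle) = ((F x : ℝ) : UnitAddCircle)) :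
    Function.Periodic (deriv F) 1 := by
  have hi : ∀ x, ∃ m : ℤ, F (x + 1) - F x = m := by
    intro x
    have h : ((F (x + 1) : ℝ) : UnitAddCircle) = (F x : ℝ) := by
      rw [← hTF, ← hTF, AddCircle.coe_add_period]
    rw [← sub_eq_zero, ← AddCircle.coe_sub, AddCircle.coe_eq_zero_iff] at h
    obtain ⟨m, hm⟩ := h
    exact ⟨m, by simpa using hm.symm⟩
  have hconst := eq_of_continuous_of_int_valued (h := fun x => F (x + 1) - F x) (by fun_prop) hi
  intro x
  have hfun : (fun y => F (y + 1)) = fun y => F y + (F (0 + 1) - F 0) := by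
    funext y
    linarith [hconst y 0]
  rw [← deriv_comp_add_const, hfun, deriv_add_const]

/-- A lift of a `C¹` expanding circle map is uniformly expanding and onto. -/
lemma exists_uniform_expansion {F : ℝ → ℝ} (hF : ContDiff ℝ 1 F)
    (hper : Function.Periodic (deriv F) 1) (hexp : ∀ x, 1 < |deriv F x|) :
    ∃ c : ℝ, 1 < c ∧ (∀ a b, c * |a - b| ≤ |F a - F b|) ∧ Function.Surjective F := by
  have hcont : Continuous (deriv F) := hF.continuous_deriv le_rfl
  have hdiff : Differentiable ℝ F := hF.differentiable one_ne_zero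
  obtain ⟨x₀, -, hx₀⟩ := isCompact_Icc.exists_isMinOn (nonempty_Icc.2 (zero_le_one' ℝ))
    hcont.abs.continuousOn
  have hmin : ∀ x, |deriv F x₀| ≤ |deriv F x| := by
    intro x
    obtain ⟨y, hy, hxy⟩ := hper.exists_mem_Ico₀ one_pos x
    rw [hxy]
    exact hx₀ ⟨hy.1, hy.2.le⟩
  refine ⟨|deriv F x₀|, hexp x₀, ?_⟩
  have hpos : 0 < |deriv F x₀| := one_pos.trans (hexp x₀)
  have hne : ∀ x, deriv F x ≠ 0 := fun x hx => by
    have := hexp x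
    simp only [hx, abs_zero] at this
    linarith
  by_cases hsign : ∃ a, 0 < deriv F a
  · obtain ⟨a, ha⟩ := hsign
    have hall : ∀ x, 0 < deriv F x := by
      intro x
      by_contra hx
      obtain ⟨z, hz⟩ := mem_range_of_exists_le_of_exists_ge hcont ⟨x, not_lt.1 hx⟩ ⟨a, ha.le⟩
      exact hne z hz
    exact expands_and_surjective_of_le_deriv hdiff hpos fun x =>
      (hmin x).trans_eq (abs_of_pos (hall x))
  · push Not at hsign
    obtain ⟨h1, h2⟩ := expands_and_surjective_of_le_deriv hdiff.neg hpos fun x => by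
      rw [deriv.neg]
      exact (hmin x).trans_eq (abs_of_nonpos (hsign x))
    refine ⟨fun a b => (h1 a b).trans_eq ?_, fun y => ?_⟩
    · simp only [Pi.neg_apply]
      rw [← abs_neg]
      congr 1
      ring
    · obtain ⟨x, hx⟩ := h2 (-y)
      exact ⟨x, neg_injective hx⟩

lemma expands_iterate {F : ℝ → ℝ} {c : ℝ} (hc : 0 ≤ c)
    (hF : ∀ a b, c * |a - b| ≤ |F a - F b|) (n : ℕ) (a b : ℝ) :
    c ^ n * |a - b| ≤ |F^[n] a - F^[n] b| := by
  induction n with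
  | zero => simp
  | succ n ih =>
    rw [Function.iterate_succ_apply', Function.iterate_succ_apply', pow_succ']
    calc c * c ^ n * |a - b| = c * (c ^ n * |a - b|) := by ring
      _ ≤ c * |F^[n] a - F^[n] b| := by gcongr
      _ ≤ _ := hF _ _

/-- Closing lemma: every translate of an expanding surjection of the line has a fixed point. -/
lemma exists_eq_add_of_expands {H : ℝ → ℝ} {c : ℝ} (hc : 1 < c)
    (hH : ∀ a b, c * |a - b| ≤ |H a - H b|) (hsurj : Function.Surjective H) (k : ℝ) :
    ∃ z, H z = z + k := by
  choose G hG using hsurj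
  have hc0 : 0 < c := one_pos.trans hc
  have hlip : LipschitzWith (Real.toNNReal c⁻¹) fun z => G (z + k) := by
    refine LipschitzWith.of_dist_le_mul fun x y => ?_
    rw [Real.coe_toNNReal _ (inv_nonneg.2 hc0.le), Real.dist_eq, Real.dist_eq,
      inv_mul_eq_div, le_div_iff₀' hc0]
    have := hH (G (x + k)) (G (y + k))
    rwa [hG, hG, add_sub_add_right_eq_sub] at this
  have hcontr : ContractingWith (Real.toNNReal c⁻¹) fun z => G (z + k) :=
    ⟨by rw [Real.toNNReal_lt_one]; exact inv_lt_one_of_one_lt₀ hc, hlip⟩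
  refine ⟨hcontr.fixedPoint, ?_⟩
  have hfix := hcontr.fixedPoint_isFixedPt
  have := hG (hcontr.fixedPoint + k)
  rwa [show G (hcontr.fixedPoint + k) = hcontr.fixedPoint from hfix] at this

/-- Birkhoff sums over a periodic orbit are integrals for an invariant measure. -/
lemma birkhoffSum_nonneg_of_isPeriodicPt {X : Type*} [MeasurableSpace X]
    [MeasurableSingletonClass X] {T : X → X} (hT : Measurable T) {f : X → ℝ}
    (hint : ∀ μ : Measure X, IsProbabilityMeasure μ →
      Measure.map T μ = μ → 0 ≤ ∫ x, f x ∂μ)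
    {n : ℕ} {p : X} (hp : Function.IsPeriodicPt T n p) : 0 ≤ birkhoffSum T f n p := by
  rcases Nat.eq_zero_or_pos n with rfl | hn
  · simp
  set ν : Measure X := ∑ i ∈ Finset.range n, Measure.dirac (T^[i] p) with hν
  have hn0 : (n : ENNReal) ≠ 0 := by exact_mod_cast hn.ne'
  have hprob : IsProbabilityMeasure ((n : ENNReal)⁻¹ • ν) := by
    constructor
    simp [hν, Measure.finsetSum_apply, ENNReal.inv_mul_cancel hn0]
  have hinv : Measure.map T ν = ν := by
    have hmap : Measure.map T ν = ∑ i ∈ Finset.range n, Measure.dirac (T^[i + 1] p) := by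
      rw [hν, ← Measure.mapₗ_apply_of_measurable hT, map_sum]
      refine Finset.sum_congr rfl fun i _ => ?_
      rw [Measure.mapₗ_apply_of_measurable hT, Measure.map_dirac' hT,
        Function.iterate_succ_apply']
    obtain ⟨m, rfl⟩ := Nat.exists_eq_succ_of_ne_zero hn.ne'
    rw [hmap, hν, Finset.sum_range_succ, Finset.sum_range_succ', hp.eq]
    simp
  have h := hint _ hprob (by rw [Measure.map_smul, hinv])
  rw [integral_smul_measure, hν, integral_finsetSum_measure fun i _ =>
    (integrable_dirac (by simp))] at h
  simp only [integral_dirac, smul_eq_mul, ENNReal.toReal_inv, ENNReal.toReal_natCast] at h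
  exact nonneg_of_mul_nonneg_right h (by positivity)

lemma iterate_lift {T : UnitAddCircle → UnitAddCircle} {F : ℝ → ℝ}
    (hTF : ∀ x : ℝ, T (x : UnitAddCircle) = ((F x : ℝ) : UnitAddCircle)) (n : ℕ) (x : ℝ) :
    T^[n] (x : UnitAddCircle) = ((F^[n] x : ℝ) : UnitAddCircle) := by
  induction n with
  | zero => rfl
  | succ n ih => rw [Function.iterate_succ_apply', ih, hTF, Function.iterate_succ_apply']

lemma dist_coe_le (a b : ℝ) : dist (a : UnitAddCircle) b ≤ |a - b| := by
  rw [dist_eq_norm, ← AddCircle.coe_sub, UnitAddCircle.norm_eq]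
  simpa using round_le (a - b) 0

lemma exists_lifts_dist_eq (x y : UnitAddCircle) :
    ∃ a b : ℝ, (a : UnitAddCircle) = x ∧ (b : UnitAddCircle) = y ∧ |a - b| = dist x y := by
  obtain ⟨a, rfl⟩ := QuotientAddGroup.mk_surjective x
  obtain ⟨b, rfl⟩ := QuotientAddGroup.mk_surjective y
  refine ⟨a, b + round (a - b), rfl, ?_, ?_⟩
  · rw [AddCircle.coe_add]
    simp
  · change _ = dist (a : UnitAddCircle) b
    rw [dist_eq_norm, ← AddCircle.coe_sub, UnitAddCircle.norm_eq, sub_add_eq_sub_sub]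

/-- Bounded distortion of Birkhoff sums along lifted orbits. -/
lemma abs_birkhoffSum_sub_le {T : UnitAddCircle → UnitAddCircle} {F : ℝ → ℝ}
    (hTF : ∀ x : ℝ, T (x : UnitAddCircle) = ((F x : ℝ) : UnitAddCircle)) {c : ℝ} (hc : 1 < c)
    (hF : ∀ a b, c * |a - b| ≤ |F a - F b|) {β : ℝ} (hβ : 0 < β) {f : UnitAddCircle → ℝ} {C : ℝ}
    (hC : 0 ≤ C) (hf : ∀ x y, |f x - f y| ≤ C * dist x y ^ β) (n : ℕ) (u v : ℝ) :
    |birkhoffSum T f n (u : UnitAddCircle) - birkhoffSum T f n (v : UnitAddCircle)| ≤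
      C / (c ^ β - 1) * |F^[n] u - F^[n] v| ^ β := by
  have hcβ : 0 < c ^ β - 1 := sub_pos.2 (Real.one_lt_rpow hc hβ)
  induction n with
  | zero => simp only [birkhoffSum_zero, sub_self, abs_zero]; positivity
  | succ n ih =>
    set K := C / (c ^ β - 1) with hK
    have hK0 : 0 ≤ K := by positivity
    have hKC : K + C = K * c ^ β := by rw [hK]; field_simp; ring
    rw [birkhoffSum_succ, birkhoffSum_succ, add_sub_add_comm, iterate_lift hTF, iterate_lift hTF,
      Function.iterate_succ_apply', Function.iterate_succ_apply']
    set a := F^[n] u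
    set b := F^[n] v
    have h1 : |f (a : UnitAddCircle) - f (b : UnitAddCircle)| ≤ C * |a - b| ^ β :=
      (hf _ _).trans (by gcongr; exact dist_coe_le a b)
    calc _ ≤ K * |a - b| ^ β + C * |a - b| ^ β := (abs_add_le _ _).trans (add_le_add ih h1)
      _ = K * (c * |a - b|) ^ β := by
        rw [Real.mul_rpow (by linarith) (abs_nonneg _), ← mul_assoc, ← hKC]; ring
      _ ≤ K * |F a - F b| ^ β := by
        gcongr
        exact hF a b

end CircleExpanding

open CircleExpanding

/-- (Contreras–Lopes–Thieullen style result on the circle.) Let `T : 𝕋 → 𝕋` be a `C¹` expanding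
map of the circle `𝕋 = ℝ/ℤ` (given by a `C¹` lift `F : ℝ → ℝ` with `|F'(x)| > 1` everywhere),
`0 < β ≤ 1`, and `f : 𝕋 → ℝ` a `β`-Hölder function with `∫ f dμ ≥ 0` for every `T`-invariant
Borel probability measure `μ`. Then `f ≥ φ - φ ∘ T` for some `β`-Hölder `φ`. -/
theorem subcoboundary_circle_expanding
    (T : UnitAddCircle → UnitAddCircle)
    (hT : ∃ F : ℝ → ℝ, ContDiff ℝ 1 F ∧ (∀ x : ℝ, T (x : UnitAddCircle) = ((F x : ℝ) : UnitAddCircle)) ∧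
      ∀ x : ℝ, 1 < |deriv F x|)
    (β : ℝ) (hβ0 : 0 < β) (hβ1 : β ≤ 1)
    (f : UnitAddCircle → ℝ)
    (hf : ∃ C : ℝ, ∀ x y : UnitAddCircle, |f x - f y| ≤ C * dist x y ^ β)
    (hint : ∀ μ : Measure UnitAddCircle, IsProbabilityMeasure μ →
      Measure.map T μ = μ → 0 ≤ ∫ x, f x ∂μ) :
    ∃ φ : UnitAddCircle → ℝ,
      (∃ C : ℝ, ∀ x y : UnitAddCircle, |φ x - φ y| ≤ C * dist x y ^ β) ∧
      ∀ x : UnitAddCircle, φ x - φ (T x) ≤ f x := by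

  obtain ⟨F, hF, hTF, hexp⟩ := hT
  obtain ⟨C₀, hf₀⟩ := hf
  obtain ⟨C, hC, hf⟩ : ∃ C : ℝ, 0 ≤ C ∧ ∀ x y, |f x - f y| ≤ C * dist x y ^ β :=
    ⟨|C₀|, abs_nonneg _, fun x y => (hf₀ x y).trans (by gcongr; exact le_abs_self _)⟩
  obtain ⟨c, hc, hFc, hsurj⟩ :=
    exists_uniform_expansion hF (periodic_deriv_of_lift hF.continuous hTF) hexp
  have hc0 : 0 < c := one_pos.trans hc
  have hTm : Measurable T := by
    have hTc : Continuous T := by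
      refine (QuotientAddGroup.isQuotientMap_mk
        (N := AddSubgroup.zmultiples (1 : ℝ))).continuous_iff.2 ?_
      have : T ∘ (QuotientAddGroup.mk : ℝ → UnitAddCircle) = fun x : ℝ => (F x : UnitAddCircle) :=
        funext hTF
      rw [this]
      exact (AddCircle.continuous_mk' 1).comp hF.continuous
    exact hTc.measurable
  have hdist := abs_birkhoffSum_sub_le hTF hc hFc hβ0 hC hf
  set K := C / (c ^ β - 1)
  have hK0 : 0 ≤ K := div_nonneg hC (sub_pos.2 (Real.one_lt_rpow hc hβ0)).le
  have hbound : ∀ n y, -(K * (1 + 1 / (c - 1)) ^ β) ≤ birkhoffSum T f n y := by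
    intro n y
    have hc1 : 0 < c - 1 := sub_pos.2 hc
    rcases Nat.eq_zero_or_pos n with rfl | hn
    · rw [birkhoffSum_zero, neg_nonpos]
      positivity
    obtain ⟨u, rfl⟩ := QuotientAddGroup.mk_surjective y
    have hcn : c ≤ c ^ n := le_self_pow₀ hc.le hn.ne'
    have hFn := expands_iterate hc0.le hFc n
    obtain ⟨z, hz⟩ := exists_eq_add_of_expands (hc.trans_le hcn) hFn (hsurj.iterate n)
      (⌊F^[n] u - u⌋ : ℝ)
    have hper : Function.IsPeriodicPt T n (z : UnitAddCircle) := by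
      change T^[n] (z : UnitAddCircle) = z
      rw [iterate_lift hTF, hz]
      simp
    have hnonneg := birkhoffSum_nonneg_of_isPeriodicPt hTm hint hper
    have htri : |F^[n] u - F^[n] z| ≤ 1 + |u - z| := by
      have heq : F^[n] u - F^[n] z = Int.fract (F^[n] u - u) + (u - z) := by
        rw [hz, Int.fract]; ring
      rw [heq]
      refine (abs_add_le _ _).trans (add_le_add_left ?_ _)
      rw [abs_of_nonneg (Int.fract_nonneg _)]
      exact (Int.fract_lt_one _).le
    have huz : |u - z| ≤ 1 / (c - 1) := by
      rw [le_div_iff₀ hc1]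
      have h1 := (hFn u z).trans htri
      have h2 : c * |u - z| ≤ c ^ n * |u - z| := by gcongr
      linarith
    have hle : K * |F^[n] u - F^[n] z| ^ β ≤ K * (1 + 1 / (c - 1)) ^ β := by
      gcongr
      linarith
    have := (abs_le.1 ((hdist n u z).trans hle)).1
    change _ ≤ birkhoffSum T f n (u : UnitAddCircle)
    linarith
  set S : UnitAddCircle → Set ℝ := fun x => {s | ∃ n y, T^[n] y = x ∧ birkhoffSum T f n y = s}
  have hbdd : ∀ x, BddBelow (S x) := by
    intro x
    refine ⟨-(K * (1 + 1 / (c - 1)) ^ β), ?_⟩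
    rintro _ ⟨n, y, -, rfl⟩
    exact hbound n y
  have hne : ∀ x, (S x).Nonempty := fun x => ⟨0, 0, x, rfl, by simp⟩
  have hholder : ∀ x y, sInf (S y) ≤ sInf (S x) + K * dist x y ^ β := by
    intro x y
    rw [← sub_le_iff_le_add]
    refine le_csInf (hne x) ?_
    rintro _ ⟨n, w, hw, rfl⟩
    obtain ⟨a, b, rfl, rfl, hab⟩ := exists_lifts_dist_eq x y
    obtain ⟨u, rfl⟩ := QuotientAddGroup.mk_surjective w
    obtain ⟨v, hv⟩ := hsurj.iterate n (b + (F^[n] u - a))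
    have hva : T^[n] (v : UnitAddCircle) = b := by
      have hu : ((F^[n] u : ℝ) : UnitAddCircle) = a := by rw [← iterate_lift hTF]; exact hw
      rw [iterate_lift hTF, hv, AddCircle.coe_add, AddCircle.coe_sub, hu]
      simp
    have h1 : sInf (S b) ≤ birkhoffSum T f n (v : UnitAddCircle) :=
      csInf_le (hbdd _) ⟨n, v, hva, rfl⟩
    have h2 := (abs_le.1 (hdist n u v)).1
    rw [hv, show F^[n] u - (b + (F^[n] u - a)) = a - b by ring, hab] at h2
    change _ ≤ birkhoffSum T f n (u : UnitAddCircle)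
    linarith
  refine ⟨fun x => -sInf (S x), ⟨K, fun x y => ?_⟩, fun x => ?_⟩
  · have h1 := hholder x y
    have h2 := hholder y x
    rw [dist_comm] at h2
    rw [abs_le]
    constructor <;> linarith
  · have : sInf (S (T x)) - f x ≤ sInf (S x) := by
      refine le_csInf (hne x) ?_
      rintro _ ⟨n, y, rfl, rfl⟩
      rw [sub_le_iff_le_add]
      refine csInf_le (hbdd _) ⟨n + 1, y, Function.iterate_succ_apply' _ _ _, ?_⟩
      rw [birkhoffSum_succ]
    linarith
end
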